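/- Let p be a prime and let k ⊆ K be fields of characteristic p such that K is a finitely generated field extension of k. For each n ≥ 0 let k(K^{p^n}) denote the subfield of K generated by k together with the set {y^{p^n} : y ∈ K}. Then every element x ∈ K which lies in k(K^{p^n}) for all n ≥ 0 is algebraic over k; that is, ⋂_{n≥0} k(K^{p^n}) is contained in the algebraic closure of k in K. -/

import Mathlib

open Polynomial

lemma aux1 {k K : Type*} [Field k] [Field K] [Algebra k K] {x : K} (hx : Transcendental k x)
    {q m : ℕ} (hq : 0 < q) (h : x ^ m ∈ IntermediateField.adjoin k {x ^ q}) : q ∣ m := by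
  obtain ⟨r, s, h⟩ := (IntermediateField.mem_adjoin_simple_iff k _).1 h
  have hx0 : x ≠ 0 := by rintro rfl; exact hx isAlgebraic_zero
  have hs : aeval (x ^ q) s ≠ 0 := by
    intro h0; rw [h0, div_zero] at h; exact pow_ne_zero _ hx0 h
  rw [eq_div_iff hs, ← expand_aeval, ← expand_aeval] at h
  have h2 : aeval x (X ^ m * expand k q s) = aeval x (expand k q r) := by simpa using h
  have h3 := transcendental_iff_injective.1 hx h2
  have hs0 : s ≠ 0 := by rintro rfl; simp at hs
  have h4 := congrArg natDegree h3
  rw [natDegree_mul (by simp) (by rwa [Ne, expand_eq_zero hq]), natDegree_X_pow, natDegree_expand,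
    natDegree_expand] at h4
  exact (Nat.dvd_add_left (Dvd.intro_left _ rfl)).1 (h4 ▸ Dvd.intro_left _ rfl)

lemma aux2 {p : ℕ} [Fact p.Prime] {k K : Type*} [Field k] [Field K] [Algebra k K] [CharP K p]
    {x : K} (hx : Transcendental k x) (n : ℕ) :
    p ^ n ≤ (minpoly (IntermediateField.adjoin k {x ^ p ^ n}) x).natDegree := by
  set F := IntermediateField.adjoin k {x ^ p ^ n} with hF
  have hp : 0 < p ^ n := pow_pos (Fact.out : p.Prime).pos n
  let a : F := ⟨x ^ p ^ n, IntermediateField.mem_adjoin_simple_self k _⟩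
  have h0 : aeval x (X ^ p ^ n - C a) = 0 := by simp [a]
  have hint : IsIntegral F x := ⟨_, monic_X_pow_sub_C a hp.ne', by simpa [aeval_def] using h0⟩
  have hd := Polynomial.map_dvd (algebraMap F K) (minpoly.dvd F x h0)
  have he : (X ^ p ^ n - C a).map (algebraMap F K) = (X - C x) ^ p ^ n := by
    rw [sub_pow_char_pow]; simp [a]
  rw [he, dvd_prime_pow (prime_X_sub_C x)] at hd
  obtain ⟨i, -, hi⟩ := hd
  have hi := eq_of_monic_of_associated ((minpoly.monic hint).map _) ((monic_X_sub_C x).pow i) hi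
  have hdeg : (minpoly F x).natDegree = i := by
    have := congrArg natDegree hi
    simpa using this
  have hc := congrArg (fun f => f.coeff 0) hi
  have hmem : x ^ i ∈ F := by
    have : (-x) ^ i ∈ F := by
      have h5 : (-x) ^ i = algebraMap F K ((minpoly F x).coeff 0) := by
        rw [← coeff_map, hc, coeff_zero_eq_eval_zero]; simp
      rw [h5]; exact Subtype.property _
    rw [neg_pow] at this
    have h6 := F.mul_mem (pow_mem (F.neg_mem F.one_mem) i) this
    rwa [← mul_assoc, ← mul_pow, neg_one_mul, neg_neg, one_pow, one_mul] at h6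
  rw [hdeg]
  exact Nat.le_of_dvd (hdeg ▸ minpoly.natDegree_pos hint) (aux1 hx hp hmem)

lemma aux3 {p : ℕ} [Fact p.Prime] {k K : Type*} [Field k] [Field K] [Algebra k K] [CharP K p]
    {x : K} [FiniteDimensional (IntermediateField.adjoin k {x}) K] (n : ℕ)
    (h : x ∈ IntermediateField.adjoin k {z : K | ∃ y : K, y ^ p ^ n = z}) :
    (minpoly (IntermediateField.adjoin k {x ^ p ^ n}) x).natDegree ≤
      Module.finrank (IntermediateField.adjoin k {x}) K := by
  set F := IntermediateField.adjoin k {x ^ p ^ n} with hF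
  set S : Set K := {z : K | ∃ y : K, y ^ p ^ n = z} with hS
  let b := Module.finBasis (IntermediateField.adjoin k {x}) K
  let V : Submodule F K := Submodule.span F (Set.range fun i => b i ^ p ^ n)
  have hpow : ∀ c ∈ IntermediateField.adjoin k {x}, c ^ p ^ n ∈ F := by
    intro c hc
    induction hc using IntermediateField.adjoin_induction with
    | mem y hy =>
      rw [Set.mem_singleton_iff.1 hy]; exact IntermediateField.mem_adjoin_simple_self k _
    | algebraMap y => rw [← map_pow]; exact F.algebraMap_mem _
    | add y z _ _ hy hz => rw [add_pow_char_pow]; exact F.add_mem hy hz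
    | mul y z _ _ hy hz => rw [mul_pow]; exact F.mul_mem hy hz
    | inv y _ hy => rw [inv_pow]; exact F.inv_mem hy
  have hSV : S ⊆ V := by
    rintro _ ⟨y, rfl⟩
    rw [← b.sum_repr y, sum_pow_char_pow]
    refine V.sum_mem fun i _ => ?_
    rw [Algebra.smul_def, mul_pow]
    exact V.smul_mem (⟨_, hpow _ (b.repr y i).2⟩ : F) (Submodule.subset_span ⟨i, rfl⟩)
  have hcl : (Submonoid.closure S : Set K) = S := by
    have := (MonoidHom.mrange (powMonoidHom (α := K) (p ^ n))).closure_eq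
    have h2 : ((MonoidHom.mrange (powMonoidHom (α := K) (p ^ n)) : Submonoid K) : Set K) = S := by
      ext z; simp [hS]
    rw [← h2, this]
  have hA : Subalgebra.toSubmodule (Algebra.adjoin F S) = V := by
    rw [Algebra.adjoin_eq_span, hcl]
    refine le_antisymm (Submodule.span_le.2 hSV) (Submodule.span_mono ?_)
    rintro _ ⟨i, rfl⟩
    exact ⟨_, rfl⟩
  have hfg : (Subalgebra.toSubmodule (Algebra.adjoin F S)).FG := by
    rw [hA]; exact Submodule.fg_span (Set.finite_range _)
  have halg : ∀ y ∈ S, IsAlgebraic F y := fun y hy =>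
    (IsIntegral.of_mem_of_fg _ hfg y (Algebra.subset_adjoin hy)).isAlgebraic
  have hx1 : x ∈ (IntermediateField.adjoin F S).restrictScalars k := by
    refine (IntermediateField.adjoin_le_iff.2 ?_) h
    exact IntermediateField.subset_adjoin F S
  have hx2 : x ∈ Algebra.adjoin F S := by
    rw [← IntermediateField.adjoin_toSubalgebra_of_isAlgebraic halg]
    exact hx1
  have hli := linearIndependent_pow (K := F) x
  have hli2 : LinearIndependent F
      (fun i : Fin (minpoly F x).natDegree => (⟨x ^ (i : ℕ), by
        rw [← hA]; exact (Algebra.adjoin F S).pow_mem hx2 _⟩ : V)) :=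
    LinearIndependent.of_comp V.subtype hli
  have : Module.Finite F V := Module.Finite.span_of_finite F (Set.finite_range _)
  have h1 := hli2.fintype_card_le_finrank
  have h2 := finrank_range_le_card (R := F) (fun i => b i ^ p ^ n)
  simp only [Fintype.card_fin] at h1 h2
  exact h1.trans h2

theorem statement9 {p : ℕ} [Fact p.Prime] {k K : Type*} [Field k] [Field K]
    [Algebra k K] [CharP K p]
    (hfg : (⊤ : IntermediateField k K).FG)
    (x : K)
    (hx : ∀ n : ℕ, x ∈ IntermediateField.adjoin k {z : K | ∃ y : K, y ^ p ^ n = z}) :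
    IsAlgebraic k x := by
  by_contra hxt
  obtain ⟨s, hs, hb⟩ := exists_isTranscendenceBasis_superset (R := k) (s := {x})
    ((algebraicIndependent_singleton_iff (⟨x, rfl⟩ : ({x} : Set K))).2 hxt)
  have hxs : x ∈ s := hs rfl
  let k' := IntermediateField.adjoin k (s \ {x})
  have htr : Transcendental k' x := by
    have h1 := hb.1.transcendental_adjoin (s := {⟨x, hxs⟩}ᶜ) (i := ⟨x, hxs⟩) (by simp)
    have h2 : ((↑) : s → K) '' {⟨x, hxs⟩}ᶜ = s \ {x} := by
      ext z; simp [and_comm]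
    rw [h2] at h1
    intro h3
    exact h1 (IntermediateField.isAlgebraic_adjoin_iff.1 h3)
  have halg : Algebra.IsAlgebraic (IntermediateField.adjoin k' {x}) K := by
    have h1 := hb.isAlgebraic_field
    rw [Subtype.range_coe] at h1
    have h2 : (IntermediateField.adjoin k' {x}).restrictScalars k = IntermediateField.adjoin k s := by
      rw [IntermediateField.adjoin_adjoin_left, Set.sdiff_union_of_subset hs]
    rw [← h2] at h1
    exact h1
  have hfin : FiniteDimensional (IntermediateField.adjoin k' {x}) K := by
    obtain ⟨t, ht⟩ := hfg
    have h1 : IntermediateField.adjoin (IntermediateField.adjoin k' {x}) (t : Set K) = ⊤ := by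
      refine top_le_iff.1 fun y _ => ?_
      have hy : y ∈ IntermediateField.adjoin k (t : Set K) := ht ▸ IntermediateField.mem_top
      have h2 : IntermediateField.adjoin k (t : Set K) ≤ ((IntermediateField.adjoin
          (IntermediateField.adjoin k' {x}) (t : Set K)).restrictScalars k').restrictScalars k :=
        IntermediateField.adjoin_le_iff.2 (IntermediateField.subset_adjoin _ _)
      exact h2 hy
    have h3 : FiniteDimensional (IntermediateField.adjoin k' {x})
        (IntermediateField.adjoin (IntermediateField.adjoin k' {x}) (t : Set K)) :=
      IntermediateField.finiteDimensional_adjoin fun y _ => (halg.isAlgebraic y).isIntegral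
    rw [h1] at h3
    exact IntermediateField.topEquiv.toLinearEquiv.finiteDimensional
  set d := Module.finrank (IntermediateField.adjoin k' {x}) K with hd
  have hle : p ^ d ≤ d := by
    refine (aux2 htr d).trans (aux3 d ?_)
    have h2 : IntermediateField.adjoin k {z : K | ∃ y : K, y ^ p ^ d = z} ≤
        (IntermediateField.adjoin k' {z : K | ∃ y : K, y ^ p ^ d = z}).restrictScalars k :=
      IntermediateField.adjoin_le_iff.2 (IntermediateField.subset_adjoin _ _)
    exact h2 (hx d)
  exact absurd hle (Nat.lt_pow_self (Fact.out : p.Prime).one_lt).not_ge
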